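/- Let p be a fixed pivot vertex and let u, v be vertices distinct from p. If L_u is the latest minimum (u,p)-cut side and L_v is the latest minimum (v,p)-cut side, then L_u ⊆ L_v, or L_v ⊆ L_u, or L_u ∩ L_v = ∅; that is, latest minimum cut sides with respect to a common pivot form a laminar family. -/

import Mathlib

open Finset

variable {V : Type*}

/-- The cut value of a set `S`: total weight of pairs crossing `(S, Sᶜ)`. -/
def cutValue [Fintype V] [DecidableEq V] (w : V → V → ℝ) (S : Finset V) : ℝ :=
  ∑ x ∈ S, ∑ y ∈ Sᶜ, w x y

/-- `S` is an `(s,t)`-cut side if `s ∈ S` and `t ∉ S`. -/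
def IsCutSide [Fintype V] [DecidableEq V] (s t : V) (S : Finset V) : Prop :=
  s ∈ S ∧ t ∉ S

/-- `S` is a minimum `(s,t)`-cut side. -/
def IsMinCutSide [Fintype V] [DecidableEq V] (w : V → V → ℝ) (s t : V) (S : Finset V) : Prop :=
  IsCutSide s t S ∧ ∀ S' : Finset V, IsCutSide s t S' → cutValue w S ≤ cutValue w S'

/-- `S` is a latest minimum `(s,t)`-cut side: a minimum cut side of minimum cardinality
among all minimum cut sides. -/
def IsLatestMinCutSide [Fintype V] [DecidableEq V] (w : V → V → ℝ) (s t : V) (S : Finset V) : Prop :=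
  IsMinCutSide w s t S ∧ ∀ S' : Finset V, IsMinCutSide w s t S' → S.card ≤ S'.card

theorem cutValue_eq_sum_ite [Fintype V] [DecidableEq V] (w : V → V → ℝ) (S : Finset V) :
    cutValue w S = ∑ x, ∑ y, if x ∈ S ∧ y ∉ S then w x y else 0 := by
  rw [cutValue, ← sum_subset (subset_univ S) fun x _ hx => by simp [hx]]
  refine sum_congr rfl fun x hx => ?_
  simp only [hx, true_and, ← mem_compl, sum_ite_mem, univ_inter]

theorem cutValue_compl [Fintype V] [DecidableEq V] (w : V → V → ℝ)
    (hsymm : ∀ x y, w x y = w y x) (S : Finset V) : cutValue w Sᶜ = cutValue w S := by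
  rw [cutValue, cutValue, compl_compl, sum_comm]
  simp only [hsymm]

theorem cutValue_inter_add_cutValue_union_le [Fintype V] [DecidableEq V] (w : V → V → ℝ)
    (hnonneg : ∀ x y, 0 ≤ w x y) (A B : Finset V) :
    cutValue w (A ∩ B) + cutValue w (A ∪ B) ≤ cutValue w A + cutValue w B := by
  simp only [cutValue_eq_sum_ite, ← sum_add_distrib]
  refine sum_le_sum fun x _ => sum_le_sum fun y _ => ?_
  have := hnonneg x y
  by_cases hxA : x ∈ A <;> by_cases hxB : x ∈ B <;> by_cases hyA : y ∈ A <;>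
    by_cases hyB : y ∈ B <;> simp [hxA, hxB, hyA, hyB, this]

theorem cutValue_sdiff_add_cutValue_sdiff_le [Fintype V] [DecidableEq V] (w : V → V → ℝ)
    (hsymm : ∀ x y, w x y = w y x) (hnonneg : ∀ x y, 0 ≤ w x y) (A B : Finset V) :
    cutValue w (A \ B) + cutValue w (B \ A) ≤ cutValue w A + cutValue w B := by
  have h := cutValue_inter_add_cutValue_union_le w hnonneg A Bᶜ
  have hBA : (A ∪ Bᶜ)ᶜ = B \ A := by
    ext x
    simp [and_comm]
  rwa [cutValue_compl w hsymm B, ← cutValue_compl w hsymm (A ∪ Bᶜ), hBA,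
    ← sdiff_eq_inter_compl] at h

theorem IsLatestMinCutSide.eq_of_subset [Fintype V] [DecidableEq V] {w : V → V → ℝ} {s t : V}
    {L S : Finset V} (hL : IsLatestMinCutSide w s t L) (hSL : S ⊆ L) (hs : s ∈ S)
    (hle : cutValue w S ≤ cutValue w L) : S = L :=
  eq_of_subset_of_card_le hSL <| hL.2 S
    ⟨⟨hs, fun ht => hL.1.1.2 (hSL ht)⟩, fun S' hS' => hle.trans (hL.1.2 S' hS')⟩

theorem IsLatestMinCutSide.subset_of_mem [Fintype V] [DecidableEq V] {w : V → V → ℝ}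
    (hnonneg : ∀ x y, 0 ≤ w x y) {s s' t : V} {L M : Finset V}
    (hL : IsLatestMinCutSide w s t L) (hM : IsMinCutSide w s' t M) (hs : s ∈ M) : L ⊆ M := by
  have hle := cutValue_inter_add_cutValue_union_le w hnonneg L M
  have hunion := hM.2 (L ∪ M) ⟨mem_union_right _ hM.1.1, by simp [hL.1.1.2, hM.1.2]⟩
  exact inter_eq_left.1 <| hL.eq_of_subset inter_subset_left (mem_inter.2 ⟨hL.1.1.1, hs⟩)
    (by linarith)

theorem latest_min_cuts_laminar [Fintype V] [DecidableEq V] [Nonempty V] (w : V → V → ℝ)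
    (hsymm : ∀ x y, w x y = w y x) (hnonneg : ∀ x y, 0 ≤ w x y)
    (hzero : ∀ x, w x x = 0)
    (p u v : V) (hu : u ≠ p) (hv : v ≠ p)
    (Lu Lv : Finset V)
    (hLu : IsLatestMinCutSide w u p Lu) (hLv : IsLatestMinCutSide w v p Lv) :
    Lu ⊆ Lv ∨ Lv ⊆ Lu ∨ Lu ∩ Lv = ∅ := by
  by_cases huv : u ∈ Lv
  · exact .inl (hLu.subset_of_mem hnonneg hLv.1 huv)
  by_cases hvu : v ∈ Lu
  · exact .inr (.inl (hLv.subset_of_mem hnonneg hLu.1 hvu))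
  refine .inr (.inr ?_)
  have hle := cutValue_sdiff_add_cutValue_sdiff_le w hsymm hnonneg Lu Lv
  have hsdiff := hLv.1.2 (Lv \ Lu) ⟨mem_sdiff.2 ⟨hLv.1.1.1, hvu⟩, by simp [hLv.1.1.2]⟩
  exact disjoint_iff_inter_eq_empty.1 <| sdiff_eq_self_iff_disjoint.1 <|
    hLu.eq_of_subset sdiff_subset (mem_sdiff.2 ⟨hLu.1.1.1, huv⟩) (by linarith)
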